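/- Every hereditarily meta-Lindelöf, locally compact, scattered Tychonoff space of Cantor–Bendixson height ω₁ is metacompact. -/

import Mathlib

open Set Topology Ordinal Cardinal

noncomputable section
universe u

/-- A topological space is *scattered* if every nonempty subset has a point isolated
in the subspace topology, i.e. there is an open set meeting the subset in exactly
that point. -/
def IsScattered (X : Type*) [TopologicalSpace X] : Prop :=
  ∀ S : Set X, S.Nonempty → ∃ x ∈ S, ∃ U : Set X, IsOpen U ∧ U ∩ S = {x}

/-- A space is *meta-Lindelöf* if every open cover has a point-countable open refinement. -/
def IsMetaLindelof (X : Type*) [TopologicalSpace X] : Prop :=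
  ∀ 𝒰 : Set (Set X), (∀ U ∈ 𝒰, IsOpen U) → ⋃₀ 𝒰 = Set.univ →
    ∃ 𝒱 : Set (Set X), (∀ V ∈ 𝒱, IsOpen V) ∧ ⋃₀ 𝒱 = Set.univ ∧
      (∀ V ∈ 𝒱, ∃ U ∈ 𝒰, V ⊆ U) ∧ ∀ x : X, {V ∈ 𝒱 | x ∈ V}.Countable

/-- A space is *hereditarily meta-Lindelöf* if every subspace is meta-Lindelöf. -/
def HereditarilyMetaLindelof (X : Type*) [TopologicalSpace X] : Prop :=
  ∀ S : Set X, IsMetaLindelof S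

/-- A space is *σ-discrete* if it is a countable union of subspaces, each of which is
discrete in its subspace topology. -/
def IsSigmaDiscrete (X : Type*) [TopologicalSpace X] : Prop :=
  ∃ D : ℕ → Set X, (⋃ n, D n) = Set.univ ∧ ∀ n, DiscreteTopology (D n)

/-- The Cantor–Bendixson derivatives `cbDeriv X α = X^(α)`: for each `β < α` we intersect
the set of non-isolated points of `X^(β)`.  This agrees with the usual transfinite
iteration: `X^(0) = X`, `X^(α+1)` is the set of non-isolated points of `X^(α)`, and at
limit ordinals one takes intersections. -/
def cbDeriv (X : Type*) [TopologicalSpace X] (o : Ordinal) : Set X :=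
  ⋂ p : {b : Ordinal // b < o},
    (cbDeriv X p.1 ∩ {x | x ∈ closure (cbDeriv X p.1 \ {x})})
termination_by o
decreasing_by exact p.2

/-- The Cantor–Bendixson height of a space: the least ordinal `α` with `X^(α) = ∅`. -/
def cbHeight (X : Type*) [TopologicalSpace X] : Ordinal :=
  sInf {o : Ordinal | cbDeriv X o = ∅}

/-- A space `X` is *Eberlein–Grothendieck* if it embeds into `C_p(K)`, the space of
continuous real-valued functions on a compact Hausdorff space `K` with the topology of
pointwise convergence (the subspace topology from the product topology on `K → ℝ`). -/
def EberleinGrothendieck (X : Type u) [TopologicalSpace X] : Prop :=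
  ∃ (K : Type u) (_ : TopologicalSpace K), CompactSpace K ∧ T2Space K ∧
    ∃ f : X → {g : K → ℝ // Continuous g}, IsEmbedding f

/-- The weight of a topological space: the least cardinality of a base for the topology. -/
def tweight (X : Type u) [TopologicalSpace X] : Cardinal.{u} :=
  sInf {c : Cardinal.{u} | ∃ B : Set (Set X), TopologicalSpace.IsTopologicalBasis B ∧ #B = c}

/-- A space is *locally countable* if every point has a countable open neighborhood. -/
def LocallyCountable (X : Type*) [TopologicalSpace X] : Prop :=
  ∀ x : X, ∃ U : Set X, IsOpen U ∧ x ∈ U ∧ U.Countable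

universe v

section ClosingOff

variable {X : Type u}

/-- `M` is closed under the set-valued operation `op` on finite sets. -/
def IsClosedUnder (op : Finset X → Set X) (M : Set X) : Prop :=
  ∀ s : Finset X, (s : Set X) ⊆ M → op s ⊆ M

/-- The least superset of `A` closed under `op`. -/
def closedHull (op : Finset X → Set X) (A : Set X) : Set X :=
  ⋂₀ {M | A ⊆ M ∧ IsClosedUnder op M}

lemma subset_closedHull (op : Finset X → Set X) (A : Set X) : A ⊆ closedHull op A :=
  subset_sInter fun _ h => h.1

lemma isClosedUnder_closedHull (op : Finset X → Set X) (A : Set X) :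
    IsClosedUnder op (closedHull op A) :=
  fun s hs => subset_sInter fun _ hM => hM.2 s (hs.trans (sInter_subset_of_mem hM))

lemma closedHull_mono (op : Finset X → Set X) {A B : Set X} (h : A ⊆ B) :
    closedHull op A ⊆ closedHull op B :=
  sInter_subset_sInter fun _ hM => ⟨h.trans hM.1, hM.2⟩

lemma mk_finset_le_max (α : Type u) : #(Finset α) ≤ max ℵ₀ #α := by
  classical
  refine le_trans (mk_le_of_surjective (f := fun l : List α => l.toFinset) ?_)
    (mk_list_le_max α)
  intro s
  exact ⟨s.toList, s.toList_toFinset⟩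

/-- One closing-off step. -/
def closingStep (op : Finset X → Set X) (A : Set X) : Set X :=
  A ∪ ⋃ s : Finset A, op (s.map (Function.Embedding.subtype _))

lemma mk_closingStep_le {op : Finset X → Set X} (hop : ∀ s, (op s).Countable) {A : Set X}
    {c : Cardinal.{u}} (hc : ℵ₀ ≤ c) (hA : #A ≤ c) : #(closingStep op A) ≤ c := by
  refine (mk_union_le _ _).trans (add_le_of_le hc hA ?_)
  refine (mk_iUnion_le _).trans (mul_le_of_le hc ((mk_finset_le_max _).trans (max_le hc hA)) ?_)
  exact ciSup_le' fun s => (le_aleph0_iff_set_countable.2 (hop _)).trans hc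

lemma mk_closedHull_le {op : Finset X → Set X} (hop : ∀ s, (op s).Countable) (A : Set X) :
    #(closedHull op A) ≤ max ℵ₀ #A := by
  set H : ℕ → Set X := fun n => (closingStep op)^[n] A with hH
  have hsucc : ∀ n, H (n + 1) = closingStep op (H n) := fun n =>
    Function.iterate_succ_apply' _ _ _
  have hcard : ∀ n, #(H n) ≤ max ℵ₀ #A := by
    intro n
    induction n with
    | zero => exact le_max_right _ _
    | succ n ih => rw [hsucc]; exact mk_closingStep_le hop (le_max_left _ _) ih
  have hmono : Monotone H := monotone_nat_of_le_succ fun n => by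
    rw [hsucc]; exact subset_union_left
  have hsub : closedHull op A ⊆ ⋃ n, H n := by
    refine sInter_subset_of_mem ⟨subset_iUnion H 0, fun s hs => ?_⟩
    have : ∃ n, (s : Set X) ⊆ H n :=
      hmono.directed_le.exists_mem_subset_of_finset_subset_biUnion hs
    obtain ⟨n, hn⟩ := this
    refine subset_trans ?_ (subset_iUnion H (n + 1))
    rw [hsucc]
    refine subset_trans ?_ subset_union_right
    classical
    refine subset_trans ?_ (subset_iUnion _ (s.subtype (· ∈ H n)))
    rw [Finset.subtype_map_of_mem fun x hx => hn hx]
  refine (mk_le_mk_of_subset hsub).trans ?_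
  have := mk_iUnion_le_lift (f := H)
  simp only [mk_nat, lift_aleph0, Cardinal.lift_uzero] at this
  exact this.trans (mul_le_of_le (le_max_left _ _) (le_max_left _ _) (ciSup_le' hcard))

lemma isClosedUnder_biUnion {ι : Type*} [LinearOrder ι] {op : Finset X → Set X} {H : ι → Set X}
    (hH : Monotone H) (hcl : ∀ i, IsClosedUnder op (H i)) {T : Set ι} (hT : T.Nonempty) :
    IsClosedUnder op (⋃ i ∈ T, H i) := by
  intro s hs
  have : ∃ i ∈ T, (s : Set X) ⊆ H i := by
    have : Nonempty T := hT.to_subtype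
    rw [biUnion_eq_iUnion] at hs
    have hd : Directed (· ⊆ ·) fun i : T => H i :=
      (hH.comp (Subtype.mono_coe (· ∈ T))).directed_le
    obtain ⟨i, hi⟩ := hd.exists_mem_subset_of_finset_subset_biUnion hs
    exact ⟨i, i.2, hi⟩
  obtain ⟨i, hi, hsi⟩ := this
  exact (hcl i s hsi).trans (subset_biUnion_of_mem (u := H) hi)

end ClosingOff

section PointFinite

variable {X : Type u}

open Classical in
/-- For a family `V` of sets and a finite set `s`, the indices `y` with `s ∩ V y ≠ ∅`, together
with one chosen point for each trace pattern realised on the sets `V y`, `y ∈ s`. -/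
def traceOp (V : X → Set X) (s : Finset X) : Set X :=
  (⋃ p ∈ s, {y | p ∈ V y}) ∪
    ⋃ t ∈ s.powerset, {z | ∃ h : ∃ z, ∀ y ∈ s, z ∈ V y ↔ y ∈ t, z = h.choose}

lemma countable_traceOp {V : X → Set X} (hV : ∀ z, {y | z ∈ V y}.Countable) (s : Finset X) :
    (traceOp V s).Countable := by
  refine (s.countable_toSet.biUnion fun p _ => hV p).union
    ((Finset.countable_toSet _).biUnion fun t _ => Set.Subsingleton.countable ?_)
  rintro a ⟨h, rfl⟩ b ⟨_, rfl⟩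
  rfl

lemma mem_of_isClosedUnder_traceOp {V : X → Set X} {M : Set X}
    (hM : IsClosedUnder (traceOp V) M) {p y : X} (hp : p ∈ M) (hy : p ∈ V y) : y ∈ M :=
  hM {p} (by simpa using hp) (Or.inl (by simpa using hy))

variable [TopologicalSpace X] [T2Space X]

/-- In a set closed under `traceOp V`, every trace of a point on the subfamily of `V` indexed by
that set is realised by one of its elements. -/
lemma exists_trace_eq {V : X → Set X} (hVo : ∀ y, IsOpen (V y)) (hVc : ∀ y, IsCompact (V y))
    (hVm : ∀ y, y ∈ V y) {M : Set X} (hM : IsClosedUnder (traceOp V) M) {z y₀ : X}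
    (hy₀ : y₀ ∈ M) (hz : z ∈ V y₀) : ∃ z' ∈ M, ∀ y ∈ M, z' ∈ V y ↔ z ∈ V y := by
  classical
  have hMc : IsClosed M := by
    rw [← isOpen_compl_iff, isOpen_iff_forall_mem_open]
    exact fun y hy => ⟨V y, fun p hp hpM => hy (mem_of_isClosedUnder_traceOp hM hpM hp),
      hVo y, hVm y⟩
  let C : M → Set X := fun y => if z ∈ V y then V y else (V y)ᶜ
  have hC : ∀ y, IsClosed (C y) := by
    intro y
    by_cases h : z ∈ V y
    · simpa [C, h] using (hVc y).isClosed
    · simpa [C, h] using (hVo y)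
  have hmemC : ∀ (w : X) (y : M), w ∈ C y ↔ (w ∈ V y ↔ z ∈ V y) := by
    intro w y
    by_cases h : z ∈ V y <;> simp [C, h]
  obtain ⟨w, ⟨_, hwM⟩, hw⟩ := ((hVc y₀).inter_right hMc).inter_iInter_nonempty C hC (by
    intro u
    let s : Finset X := insert y₀ (u.map (Function.Embedding.subtype _))
    have hs : (s : Set X) ⊆ M := by
      intro x hx
      simp only [s, Finset.coe_insert, Finset.coe_map, Set.mem_insert_iff] at hx
      rcases hx with rfl | ⟨x, -, rfl⟩
      exacts [hy₀, x.2]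
    have hex : ∃ w, ∀ y ∈ s, w ∈ V y ↔ y ∈ s.filter fun y => z ∈ V y :=
      ⟨z, fun y hy => by simp [hy]⟩
    have hmem : hex.choose ∈ M := by
      refine hM s hs (Or.inr ?_)
      simp only [mem_iUnion]
      exact ⟨s.filter fun y => z ∈ V y, by simp, hex, rfl⟩
    have hspec : ∀ y ∈ s, hex.choose ∈ V y ↔ z ∈ V y := fun y hy => by
      rw [hex.choose_spec y hy]; simp [hy]
    refine ⟨hex.choose, ⟨(hspec y₀ (by simp [s])).2 hz, hmem⟩, ?_⟩
    simp only [mem_iInter]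
    intro y hy
    refine (hmemC _ _).2 (hspec y ?_)
    simp only [s, Finset.mem_insert, Finset.mem_map]
    exact Or.inr ⟨y, hy, rfl⟩)
  refine ⟨w, hwM, fun y hy => ?_⟩
  exact (hmemC w ⟨y, hy⟩).1 (mem_iInter.1 hw _)

/-- The subfamily of `V` indexed by `Γ` has a point-finite open shrinking `W` with `y ∈ W y`. -/
def HasPointFiniteShrinking (V : X → Set X) (Γ : Set X) : Prop :=
  ∃ W : X → Set X, (∀ y ∈ Γ, IsOpen (W y) ∧ y ∈ W y ∧ W y ⊆ V y) ∧
    ∀ z, {y ∈ Γ | z ∈ W y}.Finite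

lemma hasPointFiniteShrinking_of_countable {V : X → Set X} (hVo : ∀ y, IsOpen (V y))
    (hVc : ∀ y, IsCompact (V y)) (hVm : ∀ y, y ∈ V y) {r : X → Ordinal.{v}}
    (hr : ∀ y, ∀ z ∈ V y, z ≠ y → r z < r y) {Γ : Set X} (hΓ : Γ.Countable) :
    HasPointFiniteShrinking V Γ := by
  obtain ⟨f, hf⟩ := countable_iff_exists_injOn.1 hΓ
  have hfin : ∀ n, {x ∈ Γ | f x ≤ n}.Finite := fun n =>
    Set.Finite.of_injOn (f := f) (t := Iic n) (fun x hx => hx.2) (hf.mono fun x hx => hx.1)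
      (finite_Iic n)
  refine ⟨fun y => V y \ ⋃ x ∈ {x ∈ Γ | f x < f y ∧ y ∉ V x}, V x, fun y _ => ⟨?_, ?_, ?_⟩,
    fun z => ?_⟩
  · refine (hVo y).sdiff (Set.Finite.isClosed_biUnion ?_ fun x _ => (hVc x).isClosed)
    exact (hfin (f y)).subset fun x hx => ⟨hx.1, hx.2.1.le⟩
  · refine ⟨hVm y, ?_⟩
    simp only [mem_iUnion, not_exists]
    exact fun x hx => hx.2.2
  · exact sdiff_subset
  · set S := {y ∈ Γ | z ∈ V y \ ⋃ x ∈ {x ∈ Γ | f x < f y ∧ y ∉ V x}, V x} with hS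
    rcases S.eq_empty_or_nonempty with h | h
    · rw [h]; exact finite_empty
    obtain ⟨x, hx, hmin⟩ := exists_minimalFor_of_wellFoundedLT (· ∈ S) r h
    refine (hfin (f x)).subset fun y hy => ⟨hy.1, ?_⟩
    by_contra! hlt
    have hyV : y ∈ V x := by
      by_contra hyV
      exact hy.2.2 (mem_biUnion (show x ∈ {x ∈ Γ | f x < f y ∧ y ∉ V x} from
        ⟨hx.1, hlt, hyV⟩) hx.2.1)
    have hlt' := hr x y hyV (by rintro rfl; exact lt_irrefl _ hlt)
    exact absurd (hmin hy hlt'.le) (not_le.2 hlt')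

/-- A point-countable family of compact open sets `V y ∋ y` on which the rank `r` attains its
maximum only at `y` has a point-finite open shrinking. -/
theorem hasPointFiniteShrinking {V : X → Set X} (hVo : ∀ y, IsOpen (V y))
    (hVc : ∀ y, IsCompact (V y)) (hVm : ∀ y, y ∈ V y) (hV : ∀ z, {y | z ∈ V y}.Countable)
    {r : X → Ordinal.{v}} (hr : ∀ y, ∀ z ∈ V y, z ≠ y → r z < r y) (Γ : Set X) :
    HasPointFiniteShrinking V Γ := by
  induction hκ : #Γ using WellFoundedLT.induction generalizing Γ with
  | ind κ ih =>
  rcases le_or_gt κ ℵ₀ with hle | hlt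
  · exact hasPointFiniteShrinking_of_countable hVo hVc hVm hr
      (le_aleph0_iff_set_countable.1 (hκ.trans_le hle))
  have e : κ.ord.ToType ≃ Γ := (Cardinal.eq.1 (by rw [mk_ord_toType, hκ])).some
  have hne : Nonempty κ.ord.ToType := by
    rw [← mk_ne_zero_iff, mk_ord_toType]
    exact (aleph0_pos.trans hlt).ne'
  let H : κ.ord.ToType → Set X := fun i => closedHull (traceOp V) ((fun j => (e j : X)) '' Iic i)
  have hHcl : ∀ i, IsClosedUnder (traceOp V) (H i) := fun i => isClosedUnder_closedHull _ _
  have hHm : Monotone H := fun i j hij =>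
    closedHull_mono _ (image_mono (Iic_subset_Iic.2 hij))
  have hHcard : ∀ i, #(H i) < κ := fun i => by
    refine (mk_closedHull_le (countable_traceOp hV) _).trans_lt (max_lt hlt ?_)
    refine mk_image_le.trans_lt ?_
    rw [← Iio_insert]
    refine (mk_insert_le).trans_lt (add_lt_of_lt hlt.le ?_ (one_lt_aleph0.trans hlt))
    simpa using mk_Iio_lt i (by simp)
  have hidx : ∀ y ∈ Γ, ∃ i, y ∈ H i ∧ ∀ j, y ∈ H j → i ≤ j := by
    intro y hy
    obtain ⟨i, hi, hmin⟩ := exists_minimal_of_wellFoundedLT (fun i => y ∈ H i)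
      ⟨e.symm ⟨y, hy⟩, subset_closedHull _ _ ⟨e.symm ⟨y, hy⟩, self_mem_Iic, by simp⟩⟩
    exact ⟨i, hi, fun j hj => (le_total i j).elim id fun h => hmin hj h⟩
  choose! idx hidxH hidxmin using hidx
  have hΔ : ∀ i, HasPointFiniteShrinking V {y ∈ Γ | idx y = i} := by
    intro i
    refine ih _ ?_ _ rfl
    refine (mk_le_mk_of_subset ?_).trans_lt (hHcard i)
    rintro y ⟨hy, rfl⟩
    exact hidxH y hy
  choose W hW hWfin using hΔ
  refine ⟨fun y => W (idx y) y, fun y hy => hW _ y ⟨hy, rfl⟩, fun z => ?_⟩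
  let T : Set κ.ord.ToType := {i | ∃ y ∈ Γ, idx y = i ∧ z ∈ V y}
  have hmax : ∀ T' ⊆ T, T'.Nonempty → ∃ i ∈ T', ∀ j ∈ T', j ≤ i := by
    intro T' hT' hne'
    obtain ⟨i₀, hi₀⟩ := hne'
    obtain ⟨y₀, hy₀, hy₀i, hz₀⟩ := hT' hi₀
    have hM := isClosedUnder_biUnion hHm hHcl ⟨i₀, hi₀⟩
    have hmemM : ∀ j ∈ T', ∀ y ∈ Γ, idx y = j → y ∈ ⋃ i ∈ T', H i := by
      rintro j hj y hy rfl
      exact mem_biUnion hj (hidxH y hy)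
    obtain ⟨w, hwM, hw⟩ := exists_trace_eq hVo hVc hVm hM (hmemM i₀ hi₀ y₀ hy₀ hy₀i) hz₀
    obtain ⟨i, hi, hwi⟩ := mem_iUnion₂.1 hwM
    refine ⟨i, hi, fun j hj => ?_⟩
    obtain ⟨y, hy, rfl, hz⟩ := hT' hj
    exact hidxmin y hy i (mem_of_isClosedUnder_traceOp (hHcl i) hwi
      ((hw y (hmemM _ hj y hy rfl)).2 hz))
  have hTfin : T.Finite := by
    have : WellFoundedGT T := by
      refine ⟨WellFounded.wellFounded_iff_has_min.2 fun S hS => ?_⟩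
      obtain ⟨i, ⟨i, hi, rfl⟩, hmaxi⟩ := hmax (Subtype.val '' S)
        (by rintro _ ⟨x, -, rfl⟩; exact x.2) (hS.image _)
      exact ⟨i, hi, fun x hx hlt => absurd (hmaxi x ⟨x, hx, rfl⟩) (not_le.2 hlt)⟩
    exact Finite.of_wellFoundedLT_wellFoundedGT T
  refine (hTfin.biUnion fun i _ => hWfin i z).subset ?_
  rintro y ⟨hy, hz⟩
  exact mem_biUnion (show idx y ∈ T from ⟨y, hy, rfl, (hW _ y ⟨hy, rfl⟩).2.2 hz⟩)
    ⟨⟨hy, rfl⟩, hz⟩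

end PointFinite

section Rank

variable {X : Type u} [TopologicalSpace X]

lemma cbDeriv_antitone (X : Type u) [TopologicalSpace X] :
    Antitone (cbDeriv X : Ordinal.{v} → Set X) := by
  intro a b hab x hx
  rw [cbDeriv, mem_iInter] at hx ⊢
  exact fun p => hx ⟨p.1, p.2.trans_le hab⟩

/-- A space with an empty Cantor-Bendixson derivative carries a rank function for which every
point has a neighbourhood of points of smaller rank. -/
lemma exists_rank_of_cbDeriv_eq_empty {o : Ordinal.{v}} (ho : cbDeriv X o = ∅) :
    ∃ r : X → Ordinal.{v}, (∀ x, r x < o) ∧ ∀ x, IsOpen {y | y = x ∨ r y < r x} := by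
  have key : ∀ x : X, ∃ b < o, x ∈ cbDeriv X b ∧ x ∉ closure (cbDeriv X b \ {x}) := by
    intro x
    obtain ⟨a, ha, hmin⟩ := exists_minimal_of_wellFoundedLT (fun a => x ∉ cbDeriv X a)
      ⟨o, by simp [ho]⟩
    have hao : a ≤ o := (le_total a o).elim id fun h => hmin (by simp [ho]) h
    rw [cbDeriv, mem_iInter, not_forall] at ha
    obtain ⟨⟨b, hb⟩, hxb⟩ := ha
    have hxb' : x ∈ cbDeriv X b := by
      by_contra h
      exact absurd (hmin h hb.le) (not_le.2 hb)
    exact ⟨b, hb.trans_le hao, hxb', fun h => hxb ⟨hxb', h⟩⟩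
  choose r hro hr hrc using key
  have hnhds : ∀ x, {y | y = x ∨ r y < r x} ∈ 𝓝 x := by
    intro x
    refine Filter.mem_of_superset (isClosed_closure.isOpen_compl.mem_nhds (hrc x)) fun y hy => ?_
    by_contra! h
    simp only [mem_ofPred_eq, not_or, not_lt] at h
    exact hy (subset_closure ⟨cbDeriv_antitone X h.2 (hr y), h.1⟩)
  refine ⟨r, hro, fun x => isOpen_iff_mem_nhds.2 ?_⟩
  rintro y (rfl | hy)
  · exact hnhds y
  · refine Filter.mem_of_superset (hnhds y) ?_
    rintro z (rfl | hz)
    exacts [Or.inr hy, Or.inr (hz.trans hy)]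

/-- In a hereditarily meta-Lindelöf space, the open sets on which a rank function attains its
maximum only at `y` can be shrunk to a point-countable family of open neighbourhoods. -/
lemma exists_pointCountable_nhds (hml : HereditarilyMetaLindelof X) {r : X → Ordinal.{v}}
    (hr : ∀ x, IsOpen {y | y = x ∨ r y < r x}) (a : Ordinal.{v}) :
    ∃ V : X → Set X, (∀ y, r y < a → IsOpen (V y) ∧ y ∈ V y ∧ V y ⊆ {x | x = y ∨ r x < r y}) ∧
      ∀ z, {y | r y < a ∧ z ∈ V y}.Countable := by
  induction a using WellFoundedLT.induction with
  | ind a ih =>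
  rcases isEmpty_or_nonempty X with hX | hX
  · exact ⟨fun _ => ∅, fun y => hX.elim y, fun z => hX.elim z⟩
  choose! Vr hVr hVrc using ih
  let S : Set X := {x | r x < a}
  let N : X → Set X := fun x => {y | y = x ∨ r y < r x}
  have hNS : ∀ x ∈ S, N x ⊆ S := by
    rintro x hx y (rfl | hy)
    exacts [hx, hy.trans hx]
  have hS : IsOpen S := by
    have : S = ⋃ x ∈ S, N x := by
      refine subset_antisymm (fun x hx => mem_biUnion (t := N) hx (Or.inl rfl)) (iUnion₂_subset hNS)
    rw [this]
    exact isOpen_biUnion fun x _ => hr x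
  obtain ⟨𝒱, hVo, hVcov, hVref, hVcount⟩ := hml S (range fun x : S => Subtype.val ⁻¹' N x)
    (by rintro _ ⟨x, rfl⟩; exact (hr x).preimage continuous_subtype_val)
    (by
      refine eq_univ_of_forall fun x => ?_
      exact ⟨_, ⟨x, rfl⟩, Or.inl rfl⟩)
  have hb : ∀ V ∈ 𝒱, ∃ x ∈ S, Subtype.val '' V ⊆ N x := by
    intro V hV
    obtain ⟨_, ⟨x, rfl⟩, hx⟩ := hVref V hV
    exact ⟨x, x.2, image_subset_iff.2 hx⟩
  choose! b hbS hbN using hb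
  have hc : ∀ y ∈ S, ∃ V ∈ 𝒱, y ∈ Subtype.val '' V := by
    intro y hy
    obtain ⟨V, hV, hyV⟩ : (⟨y, hy⟩ : S) ∈ ⋃₀ 𝒱 := hVcov ▸ mem_univ _
    exact ⟨V, hV, _, hyV, rfl⟩
  choose! c hc𝒱 hcy using hc
  have hcase : ∀ y ∈ S, y = b (c y) ∨ r y < r (b (c y)) := fun y hy =>
    hbN _ (hc𝒱 y hy) (hcy y hy)
  have hbr : ∀ y ∈ S, r (b (c y)) < a := fun y hy => hbS _ (hc𝒱 y hy)
  classical
  refine ⟨fun y => Subtype.val '' c y ∩ if y = b (c y) then N y else Vr (r (b (c y))) y,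
    fun y hy => ?_, fun z => ?_⟩
  · beta_reduce
    have hop : IsOpen (Subtype.val '' c y) := hS.isOpenMap_subtype_val _ (hVo _ (hc𝒱 y hy))
    by_cases h : y = b (c y)
    · rw [if_pos h]
      exact ⟨hop.inter (hr y), ⟨hcy y hy, Or.inl rfl⟩, inter_subset_right⟩
    · rw [if_neg h]
      obtain ⟨h1, h2, h3⟩ := hVr _ (hbr y hy) y ((hcase y hy).resolve_left h)
      exact ⟨hop.inter h1, ⟨hcy y hy, h2⟩, inter_subset_right.trans h3⟩
  · have hcount : {V ∈ 𝒱 | z ∈ Subtype.val '' V}.Countable := by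
      by_cases hz : z ∈ S
      · refine (hVcount ⟨z, hz⟩).mono ?_
        rintro V ⟨hV, w, hw, rfl⟩
        exact ⟨hV, hw⟩
      · refine countable_empty.mono ?_
        rintro V ⟨hV, w, hw, rfl⟩
        exact hz w.2
    refine (hcount.biUnion fun V hV =>
      (hVrc (r (b V)) (hbS V hV.1) z).union (countable_singleton (b V))).mono ?_
    rintro y ⟨hy, hzc, hz⟩
    refine mem_biUnion (show c y ∈ {V ∈ 𝒱 | z ∈ Subtype.val '' V} from ⟨hc𝒱 y hy, hzc⟩) ?_
    by_cases h : y = b (c y)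
    · exact Or.inr h
    · rw [if_neg h] at hz
      exact Or.inl ⟨(hcase y hy).resolve_left h, hz⟩

end Rank

section Clopen

variable {X : Type u} [TopologicalSpace X]

lemma IsScattered.totallyDisconnectedSpace [T1Space X] (h : IsScattered X) :
    TotallyDisconnectedSpace X := by
  refine ⟨fun S _ hS => ?_⟩
  by_contra hsub
  rw [not_subsingleton_iff] at hsub
  obtain ⟨x, hx, U, hU, hUS⟩ := h S hsub.nonempty
  obtain ⟨y, hy, hyx⟩ := hsub.exists_ne x
  have hxU : x ∈ U := (hUS.symm ▸ mem_singleton x : x ∈ U ∩ S).1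
  obtain ⟨z, hzS, hzU, hzx⟩ := hS U {x}ᶜ hU isOpen_compl_singleton
    (fun w _ => by
      by_cases hw : w = x
      · exact Or.inl (hw ▸ hxU)
      · exact Or.inr hw) ⟨x, hx, hxU⟩ ⟨y, hy, hyx⟩
  exact hzx (hUS ▸ (⟨hzU, hzS⟩ : z ∈ U ∩ S) : z ∈ ({x} : Set X))

lemma IsScattered.exists_isCompact_isOpen_subset [T2Space X] [LocallyCompactSpace X]
    (h : IsScattered X) {x : X} {U : Set X} (hU : IsOpen U) (hx : x ∈ U) :
    ∃ V, IsCompact V ∧ IsOpen V ∧ x ∈ V ∧ V ⊆ U := by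
  have := h.totallyDisconnectedSpace
  obtain ⟨K, hK, hxK, hKU⟩ := exists_compact_subset hU hx
  obtain ⟨V, hV, hxV, hVK⟩ := loc_compact_Haus_tot_disc_of_zero_dim.mem_nhds_iff.1
    (isOpen_interior.mem_nhds hxK)
  exact ⟨V, hK.of_isClosed_subset hV.1 (hVK.trans interior_subset), hV.2, hxV,
    (hVK.trans interior_subset).trans hKU⟩

end Clopen

/-- Every hereditarily meta-Lindelöf, locally compact, scattered Tychonoff space of
Cantor–Bendixson height `ω₁` is metacompact: every open cover has a point-finite open
refinement. -/
theorem metacompact_of_heredMetaLindelof_locallyCompact_scattered_height_omega1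
    (X : Type u) [TopologicalSpace X] [T35Space X] [LocallyCompactSpace X]
    (hml : HereditarilyMetaLindelof X) (hsc : IsScattered X)
    (hht : cbHeight X = ω₁) :
    ∀ 𝒰 : Set (Set X), (∀ U ∈ 𝒰, IsOpen U) → ⋃₀ 𝒰 = Set.univ →
      ∃ 𝒱 : Set (Set X), (∀ V ∈ 𝒱, IsOpen V) ∧ ⋃₀ 𝒱 = Set.univ ∧
        (∀ V ∈ 𝒱, ∃ U ∈ 𝒰, V ⊆ U) ∧ ∀ x : X, {V ∈ 𝒱 | x ∈ V}.Finite := by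
  intro 𝒰 h𝒰o h𝒰c
  have hemp : cbDeriv X ω₁ = ∅ := by
    have hne : {o | cbDeriv X o = ∅}.Nonempty := by
      by_contra h
      rw [not_nonempty_iff_eq_empty] at h
      rw [cbHeight, h, Ordinal.sInf_empty] at hht
      exact (Ordinal.omega_pos 1).ne hht
    have := csInf_mem hne
    rwa [← cbHeight, hht] at this
  obtain ⟨r, hro, hr⟩ := exists_rank_of_cbDeriv_eq_empty hemp
  obtain ⟨V₀, hV₀, hV₀c⟩ := exists_pointCountable_nhds hml hr ω₁
  have hV : ∀ y, ∃ V, IsCompact V ∧ IsOpen V ∧ y ∈ V ∧ V ⊆ V₀ y ∧ ∃ U ∈ 𝒰, V ⊆ U := by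
    intro y
    obtain ⟨U, hU, hyU⟩ : y ∈ ⋃₀ 𝒰 := h𝒰c ▸ mem_univ y
    obtain ⟨V, h1, h2, h3, h4⟩ := hsc.exists_isCompact_isOpen_subset
      ((hV₀ y (hro y)).1.inter (h𝒰o U hU)) ⟨(hV₀ y (hro y)).2.1, hyU⟩
    exact ⟨V, h1, h2, h3, h4.trans inter_subset_left, U, hU, h4.trans inter_subset_right⟩
  choose V hVc hVo hVm hVV₀ hV𝒰 using hV
  have hVcount : ∀ z, {y | z ∈ V y}.Countable := fun z => by
    refine (hV₀c z).mono ?_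
    exact fun y hy => ⟨hro y, hVV₀ y hy⟩
  obtain ⟨W, hW, hWfin⟩ := hasPointFiniteShrinking hVo hVc hVm hVcount
    (fun y z hz hzy => ((hV₀ y (hro y)).2.2 (hVV₀ y hz)).resolve_left hzy) univ
  refine ⟨range W, ?_, ?_, ?_, fun x => ?_⟩
  · rintro _ ⟨y, rfl⟩
    exact (hW y (mem_univ y)).1
  · refine Set.eq_univ_of_forall fun y => ?_
    exact ⟨W y, ⟨y, rfl⟩, (hW y (mem_univ y)).2.1⟩
  · rintro _ ⟨y, rfl⟩
    obtain ⟨U, hU, hVU⟩ := hV𝒰 y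
    exact ⟨U, hU, (hW y (mem_univ y)).2.2.trans hVU⟩
  · refine ((hWfin x).image W).subset ?_
    rintro _ ⟨⟨y, rfl⟩, hx⟩
    exact ⟨y, ⟨mem_univ y, hx⟩, rfl⟩
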